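/- Let G be a finite group in which every non-trivial irreducible representation has dimension at least d. Let A and B be subsets of G^t with densities α = |A|/|G|^t and β = |B|/|G|^t, and let X, Y be uniform on A, B respectively and independent. Then for every g in G, |P[X_1 Y_1 ... X_t Y_t = g] - 1/|G|| ≤ (1/|G|) * d^{-(t-1)} * (αβ)^{-1/2}. -/

import Mathlib

lemma trace_mulLeft_pi_matrix {ι : Type*} [Fintype ι] (D : ι → ℕ)
    (a : ∀ i, Matrix (Fin (D i)) (Fin (D i)) ℂ) :
    LinearMap.trace ℂ _ (LinearMap.mulLeft ℂ a) = ∑ i, (D i : ℂ) * (a i).trace := by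
  classical
  rw [LinearMap.trace_eq_matrix_trace ℂ
    (Pi.basis fun i => Matrix.stdBasis ℂ (Fin (D i)) (Fin (D i))),
    Matrix.trace, Fintype.sum_sigma]
  refine Finset.sum_congr rfl fun i _ => ?_
  have h (p q : Fin (D i)) : (LinearMap.toMatrix
      (Pi.basis fun i => Matrix.stdBasis ℂ (Fin (D i)) (Fin (D i)))
      (Pi.basis fun i => Matrix.stdBasis ℂ (Fin (D i)) (Fin (D i)))
      (LinearMap.mulLeft ℂ a)) ⟨i, (p, q)⟩ ⟨i, (p, q)⟩ = a i p p := by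
    rw [LinearMap.toMatrix_apply, Pi.basis_apply, Pi.basis_repr, Matrix.stdBasis_eq_single]
    simp [Matrix.stdBasis]
  rw [Fintype.sum_prod_type]
  simp only [Matrix.diag, h]
  simp [Matrix.trace, Finset.mul_sum]

lemma trace_mulLeft_monoidAlgebra_of {G : Type*} [Group G] [Fintype G] [DecidableEq G] (g : G) :
    LinearMap.trace ℂ _ (LinearMap.mulLeft ℂ (MonoidAlgebra.of ℂ G g)) =
      if g = 1 then (Fintype.card G : ℂ) else 0 := by
  rw [LinearMap.trace_eq_matrix_trace ℂ (MonoidAlgebra.basis G ℂ), Matrix.trace]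
  have h (x : G) : (LinearMap.toMatrix (MonoidAlgebra.basis G ℂ) (MonoidAlgebra.basis G ℂ)
      (LinearMap.mulLeft ℂ (MonoidAlgebra.of ℂ G g))).diag x = if g = 1 then 1 else 0 := by
    rw [Matrix.diag, LinearMap.toMatrix_apply]
    simp [MonoidAlgebra.basis, MonoidAlgebra.single_mul_single, Finsupp.single_apply]
  rw [Finset.sum_congr rfl fun x _ => h x]
  simp

open ComplexOrder MatrixOrder in
/-- Every matrix representation of a finite group is similar to a unitary one. -/
lemma exists_unitarization {G : Type*} [Group G] [Fintype G] {m : ℕ}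
    (ρ : G →* Matrix (Fin m) (Fin m) ℂ) :
    ∃ U : G →* Matrix (Fin m) (Fin m) ℂ, (∀ g, (U g).conjTranspose = U g⁻¹) ∧
      ∀ g, (U g).trace = (ρ g).trace := by
  classical
  set H : Matrix (Fin m) (Fin m) ℂ := ∑ g, (ρ g).conjTranspose * ρ g with hH
  have hpd : H.PosDef := by
    refine Matrix.posDef_sum Finset.univ_nonempty fun g _ => ?_
    refine (Matrix.posSemidef_conjTranspose_mul_self (ρ g)).posDef_iff_isUnit.mpr ?_
    have : IsUnit (ρ g) := (Group.isUnit g).map ρ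
    exact this.star.mul this
  have hinv (x : G) : (ρ x).conjTranspose * H * ρ x = H := by
    rw [hH, Finset.mul_sum, Finset.sum_mul]
    rw [← Equiv.sum_comp (Equiv.mulRight x) fun g => (ρ g).conjTranspose * ρ g]
    simp [Matrix.conjTranspose_mul, mul_assoc]
  obtain ⟨S, hS⟩ := CStarAlgebra.nonneg_iff_eq_star_mul_self.mp hpd.posSemidef.nonneg
  rw [Matrix.star_eq_conjTranspose] at hS
  have hSu : IsUnit S := by
    have h := hpd.isUnit
    rw [Matrix.isUnit_iff_isUnit_det] at h ⊢
    rw [hS, Matrix.det_mul] at h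
    exact isUnit_of_mul_isUnit_right h
  obtain ⟨s, rfl⟩ := hSu
  refine ⟨⟨⟨fun g => s * ρ g * (s⁻¹ : (Matrix (Fin m) (Fin m) ℂ)ˣ), by simp⟩, fun x y => by
    simp [mul_assoc]⟩, fun g => ?_, fun g => ?_⟩
  · have h1 := hinv g
    rw [hS] at h1
    have h2 : (s : Matrix (Fin m) (Fin m) ℂ).conjTranspose * s * ρ g⁻¹
        = (ρ g).conjTranspose * ((s : Matrix (Fin m) (Fin m) ℂ).conjTranspose * s) := by
      have h := congrArg (· * ρ g⁻¹) h1
      simp only [mul_assoc, ← map_mul, mul_inv_cancel, map_one, mul_one] at h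
      simpa only [mul_assoc] using h.symm
    have h3 : ((s⁻¹ : (Matrix (Fin m) (Fin m) ℂ)ˣ) : Matrix (Fin m) (Fin m) ℂ).conjTranspose *
        (s : Matrix (Fin m) (Fin m) ℂ).conjTranspose = 1 := by
      rw [← Matrix.conjTranspose_mul]; simp
    simp only [MonoidHom.coe_mk, OneHom.coe_mk, Matrix.conjTranspose_mul]
    calc _ = ((s⁻¹ : (Matrix (Fin m) (Fin m) ℂ)ˣ) : Matrix (Fin m) (Fin m) ℂ).conjTranspose *
          ((ρ g).conjTranspose * ((s : Matrix (Fin m) (Fin m) ℂ).conjTranspose * s)) *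
          (s⁻¹ : (Matrix (Fin m) (Fin m) ℂ)ˣ) := by simp [mul_assoc]
      _ = _ := by rw [← h2, ← mul_assoc, ← mul_assoc, h3, one_mul]
  · simp only [MonoidHom.coe_mk, OneHom.coe_mk]
    rw [Matrix.trace_mul_comm, ← mul_assoc]; simp

/-- The group elements sum to zero in a non-trivial irreducible representation. -/
lemma sum_eq_zero_of_scalar_commutant {G : Type*} [Group G] [Fintype G] {m : ℕ}
    (ρ : G →* Matrix (Fin m) (Fin m) ℂ)
    (hρ : ∀ M : Matrix (Fin m) (Fin m) ℂ, (∀ g : G, M * ρ g = ρ g * M) →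
        ∃ c : ℂ, M = c • (1 : Matrix (Fin m) (Fin m) ℂ))
    (hne : ∃ g : G, ρ g ≠ 1) : ∑ g, ρ g = 0 := by
  have hl (x : G) : ρ x * ∑ g, ρ g = ∑ g, ρ g := by
    rw [Finset.mul_sum, ← Equiv.sum_comp (Equiv.mulLeft x) ρ]
    simp
  have hr (x : G) : (∑ g, ρ g) * ρ x = ∑ g, ρ g := by
    rw [Finset.sum_mul, ← Equiv.sum_comp (Equiv.mulRight x) ρ]
    simp
  obtain ⟨c, hc⟩ := hρ _ fun g => (hr g).trans (hl g).symm
  obtain ⟨g, hg⟩ := hne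
  have h := hl g
  rw [hc, mul_smul_comm, mul_one] at h
  have : c • (ρ g - 1) = 0 := by rw [smul_sub, h, sub_self]
  rcases smul_eq_zero.mp this with h0 | h0
  · rw [hc, h0, zero_smul]
  · exact absurd (sub_eq_zero.mp h0) hg

/-- Irreducible representations whose characters, weighted by dimension, sum to
the regular character. -/
lemma exists_irreducible_plancherel (G : Type*) [Group G] [Fintype G] [DecidableEq G] :
    ∃ (n : ℕ) (D : Fin n → ℕ) (ρ : ∀ i, G →* Matrix (Fin (D i)) (Fin (D i)) ℂ),
      (∀ i, ∀ M : Matrix (Fin (D i)) (Fin (D i)) ℂ, (∀ g : G, M * ρ i g = ρ i g * M) →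
        ∃ c : ℂ, M = c • (1 : Matrix (Fin (D i)) (Fin (D i)) ℂ)) ∧
      ∀ g, ∑ i, (D i : ℂ) * (ρ i g).trace = if g = 1 then (Fintype.card G : ℂ) else 0 := by
  classical
  obtain ⟨n, D, -, ⟨e⟩⟩ :=
    IsSemisimpleRing.exists_algEquiv_pi_matrix_of_isAlgClosed ℂ (MonoidAlgebra ℂ G)
  let π (i : Fin n) : MonoidAlgebra ℂ G →ₐ[ℂ] Matrix (Fin (D i)) (Fin (D i)) ℂ :=
    (Pi.evalAlgHom ℂ _ i).comp e.toAlgHom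
  refine ⟨n, D, fun i => (π i : MonoidAlgebra ℂ G →* _).comp (MonoidAlgebra.of ℂ G),
    fun i M hM => ?_, fun g => ?_⟩
  · have hcomm (a : MonoidAlgebra ℂ G) : M * π i a = π i a * M := by
      induction a using MonoidAlgebra.induction_on with
      | of g => exact hM g
      | add a b ha hb => rw [map_add, mul_add, add_mul, ha, hb]
      | smul r a ha => rw [map_smul, mul_smul_comm, smul_mul_assoc, ha]
    have hsurj (N : Matrix (Fin (D i)) (Fin (D i)) ℂ) : ∃ a, π i a = N :=
      ⟨e.symm (Pi.single i N), by simp [π]⟩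
    obtain ⟨c, hc⟩ := Matrix.mem_range_scalar_iff_commute_single'.mpr fun p q => by
      obtain ⟨a, ha⟩ := hsurj (Matrix.single p q 1)
      rw [← ha]
      exact (hcomm a).symm
    exact ⟨c, by rw [← hc, Matrix.scalar_apply, Matrix.smul_one_eq_diagonal]⟩
  · rw [← trace_mulLeft_monoidAlgebra_of g, ← LinearMap.trace_conj' _ e.toLinearEquiv]
    have : e.toLinearEquiv.conj (LinearMap.mulLeft ℂ (MonoidAlgebra.of ℂ G g)) =
        LinearMap.mulLeft ℂ (e (MonoidAlgebra.of ℂ G g)) := by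
      refine LinearMap.ext fun x => ?_
      simp [LinearEquiv.conj_apply]
    rw [this, trace_mulLeft_pi_matrix]
    rfl

/-- Unitary form of the decomposition of the regular character; `s` indexes the non-trivial part,
where every dimension is at least `d`. -/
lemma exists_unitary_plancherel {G : Type*} [Group G] [Fintype G] [DecidableEq G] (d : ℕ)
    (hquasi : ∀ (n : ℕ) (ρ : G →* Matrix (Fin n) (Fin n) ℂ),
      (∀ M : Matrix (Fin n) (Fin n) ℂ, (∀ g : G, M * ρ g = ρ g * M) →
        ∃ c : ℂ, M = c • (1 : Matrix (Fin n) (Fin n) ℂ)) →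
      (∃ g : G, ρ g ≠ 1) → d ≤ n) :
    ∃ (n : ℕ) (D : Fin n → ℕ) (U : ∀ i, G →* Matrix (Fin (D i)) (Fin (D i)) ℂ)
      (s : Finset (Fin n)),
      (∀ i g, (U i g).conjTranspose = U i g⁻¹) ∧ (∀ i ∈ s, d ≤ D i) ∧
      (∀ g, ∑ i, (D i : ℂ) * (U i g).trace = if g = 1 then (Fintype.card G : ℂ) else 0) ∧
      ∀ g, ∑ i ∈ s, (D i : ℂ) * (U i g).trace =
        (if g = 1 then (Fintype.card G : ℂ) else 0) - 1 := by
  classical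
  obtain ⟨n, D, ρ, hirr, htr⟩ := exists_irreducible_plancherel G
  choose U hU hUtr using fun i => exists_unitarization (ρ i)
  let s : Finset (Fin n) := {i | ∃ g, ρ i g ≠ 1}
  have htriv (i) (hi : i ∈ sᶜ) (g : G) : (ρ i g).trace = D i := by
    have : ρ i g = 1 := by
      simp only [s, Finset.mem_compl, Finset.mem_filter_univ, not_exists, not_not] at hi
      exact hi g
    simp [this]
  have hone : ∑ i ∈ sᶜ, (D i : ℂ) * D i = 1 := by
    have h : ∑ g : G, ∑ i, (D i : ℂ) * (ρ i g).trace = Fintype.card G := by simp [htr]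
    rw [Finset.sum_comm, ← Finset.sum_add_sum_compl s] at h
    have h0 : ∑ i ∈ s, ∑ g, (D i : ℂ) * (ρ i g).trace = 0 := by
      refine Finset.sum_eq_zero fun i hi => ?_
      rw [← Finset.mul_sum, ← Matrix.trace_sum, sum_eq_zero_of_scalar_commutant (ρ i) (hirr i)
        (by simpa [s] using hi)]
      simp
    have h1 : ∑ i ∈ sᶜ, ∑ g, (D i : ℂ) * (ρ i g).trace =
        Fintype.card G * ∑ i ∈ sᶜ, (D i : ℂ) * D i := by
      rw [Finset.mul_sum]
      refine Finset.sum_congr rfl fun i hi => ?_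
      simp [htriv i hi]
    rw [h0, h1, zero_add] at h
    exact mul_left_cancel₀ (Nat.cast_ne_zero.mpr Fintype.card_ne_zero) (h.trans (mul_one _).symm)
  refine ⟨n, D, U, s, hU, fun i hi => hquasi _ (ρ i) (hirr i) (by simpa [s] using hi),
    fun g => by simp_rw [hUtr, htr], fun g => ?_⟩
  simp_rw [hUtr]
  rw [← htr g, ← hone, ← Finset.sum_add_sum_compl s, eq_sub_iff_add_eq]
  congr 1
  exact Finset.sum_congr rfl fun i hi => by rw [htriv i hi]

open scoped ComplexConjugate in
/-- Parseval's identity for tensor powers of a tight frame. -/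
lemma sum_norm_sq_tensor {X J : Type*} [Fintype X] [DecidableEq X] [Fintype J] (t N : ℕ)
    (φ : J → X → ℂ) (hφ : ∀ x y, ∑ j, φ j x * conj (φ j y) = if x = y then (N : ℂ) else 0)
    (f : (Fin t → X) → ℂ) :
    ∑ κ : Fin t → J, ‖∑ x, f x * ∏ k, φ (κ k) (x k)‖ ^ 2 = (N : ℝ) ^ t * ∑ x, ‖f x‖ ^ 2 := by
  classical
  have hprod (x y : Fin t → X) : ∑ κ : Fin t → J, (∏ k, φ (κ k) (x k)) *
      conj (∏ k, φ (κ k) (y k)) = if x = y then (N : ℂ) ^ t else 0 := by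
    simp only [map_prod, ← Finset.prod_mul_distrib]
    rw [← Fintype.prod_sum fun k j => φ j (x k) * conj (φ j (y k))]
    simp only [hφ]
    split_ifs with h
    · simp [h]
    · obtain ⟨k, hk⟩ := Function.ne_iff.mp h
      exact Finset.prod_eq_zero (Finset.mem_univ k) (if_neg hk)
  have h : (∑ κ : Fin t → J, ((‖∑ x, f x * ∏ k, φ (κ k) (x k)‖ ^ 2 : ℝ) : ℂ)) =
      (N : ℂ) ^ t * ∑ x, ((‖f x‖ ^ 2 : ℝ) : ℂ) := by
    calc _ = ∑ κ : Fin t → J, ∑ x, ∑ y, f x * conj (f y) *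
          ((∏ k, φ (κ k) (x k)) * conj (∏ k, φ (κ k) (y k))) := by
          refine Finset.sum_congr rfl fun κ _ => ?_
          rw [Complex.ofReal_pow, ← Complex.mul_conj', map_sum, Finset.sum_mul_sum]
          refine Finset.sum_congr rfl fun x _ => Finset.sum_congr rfl fun y _ => ?_
          rw [map_mul]; ring
      _ = ∑ x, ∑ y, f x * conj (f y) * if x = y then (N : ℂ) ^ t else 0 := by
          rw [Finset.sum_comm]
          refine Finset.sum_congr rfl fun x _ => ?_
          rw [Finset.sum_comm]
          refine Finset.sum_congr rfl fun y _ => ?_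
          rw [← Finset.mul_sum, hprod]
      _ = _ := by
          simp [Complex.mul_conj', Finset.mul_sum, mul_comm]
  exact_mod_cast h

open scoped ComplexConjugate in
/-- Bessel's inequality for matrix coefficients of the representations `U i ⊗ ⋯ ⊗ U i` of `G ^ t`. -/
lemma sum_pow_mul_coeff_le {G : Type*} [Group G] [Fintype G] [DecidableEq G] {n : ℕ}
    (D : Fin n → ℕ) (U : ∀ i, G →* Matrix (Fin (D i)) (Fin (D i)) ℂ)
    (hU : ∀ i g, (U i g).conjTranspose = U i g⁻¹)
    (htr : ∀ g, ∑ i, (D i : ℂ) * (U i g).trace = if g = 1 then (Fintype.card G : ℂ) else 0)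
    {t : ℕ} (ht : 0 < t) (f : (Fin t → G) → ℂ) :
    ∑ i, (D i : ℝ) ^ t * ∑ a : Fin t → Fin (D i), ∑ b : Fin t → Fin (D i),
      ‖∑ x, f x * ∏ k, U i (x k) (a k) (b k)‖ ^ 2 ≤
      (Fintype.card G : ℝ) ^ t * ∑ x, ‖f x‖ ^ 2 := by
  classical
  let φ (j : Σ i, Fin (D i) × Fin (D i)) (x : G) : ℂ :=
    (Real.sqrt (D j.1) : ℂ) * U j.1 x j.2.1 j.2.2
  have hφ (x y : G) : ∑ j, φ j x * conj (φ j y) =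
      if x = y then (Fintype.card G : ℂ) else 0 := by
    rw [Fintype.sum_sigma]
    have := htr (x * y⁻¹)
    simp only [mul_inv_eq_one] at this
    rw [← this]
    refine Finset.sum_congr rfl fun i _ => ?_
    rw [map_mul, ← hU, Fintype.sum_prod_type]
    have hs : (Real.sqrt (D i) : ℂ) * Real.sqrt (D i) = D i := by
      rw [← Complex.ofReal_mul, Real.mul_self_sqrt (Nat.cast_nonneg _), Complex.ofReal_natCast]
    simp only [Matrix.trace, Matrix.diag, Matrix.mul_apply, Finset.mul_sum,
      Matrix.conjTranspose_apply, φ, map_mul, Complex.conj_ofReal, ← hs]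
    refine Finset.sum_congr rfl fun a _ => Finset.sum_congr rfl fun b _ => ?_
    rw [starRingEnd_apply]; ring
  rw [← sum_norm_sq_tensor t _ φ hφ f]
  let ι (p : Σ i, (Fin t → Fin (D i)) × (Fin t → Fin (D i))) :
    Fin t → Σ i, Fin (D i) × Fin (D i) := fun k => ⟨p.1, p.2.1 k, p.2.2 k⟩
  have hι : Function.Injective ι := by
    rintro ⟨i, a, b⟩ ⟨j, a', b'⟩ h
    obtain rfl : i = j := congrArg Sigma.fst (congrFun h ⟨0, ht⟩)
    have h' (k) : a k = a' k ∧ b k = b' k := by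
      simpa [ι] using congrFun h k
    rw [funext fun k => (h' k).1, funext fun k => (h' k).2]
  calc _ = ∑ p, ‖∑ x, f x * ∏ k, φ (ι p k) (x k)‖ ^ 2 := by
        rw [Fintype.sum_sigma]
        refine Finset.sum_congr rfl fun i _ => ?_
        rw [Fintype.sum_prod_type, Finset.mul_sum]
        refine Finset.sum_congr rfl fun a _ => ?_
        rw [Finset.mul_sum]
        refine Finset.sum_congr rfl fun b _ => ?_
        have h : ∑ x, f x * ∏ k, φ (ι ⟨i, a, b⟩ k) (x k) =
            (Real.sqrt (D i) : ℂ) ^ t * ∑ x, f x * ∏ k, U i (x k) (a k) (b k) := by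
          rw [Finset.mul_sum]
          refine Finset.sum_congr rfl fun x _ => ?_
          simp only [φ, ι, Finset.prod_mul_distrib, Finset.prod_const, Finset.card_univ,
            Fintype.card_fin]
          ring
        rw [h, norm_mul, mul_pow, norm_pow, Complex.norm_real, Real.norm_of_nonneg
          (Real.sqrt_nonneg _), ← pow_mul, mul_comm t, pow_mul, Real.sq_sqrt (Nat.cast_nonneg _)]
    _ = ∑ κ ∈ Finset.univ.map ⟨ι, hι⟩, ‖∑ x, f x * ∏ k, φ (κ k) (x k)‖ ^ 2 := by
        rw [Finset.sum_map]; rfl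
    _ ≤ _ := Finset.sum_le_sum_of_subset_of_nonneg (Finset.subset_univ _)
        fun _ _ _ => sq_nonneg _

lemma list_prod_ofFn_apply {R : Type*} [CommSemiring R] {ι : Type*} [Fintype ι] [DecidableEq ι]
    (s : ℕ) (N : Fin (s + 1) → Matrix ι ι R) (p q : ι) :
    (List.ofFn N).prod p q = ∑ a : Fin s → ι, ∏ k,
      N k ((Fin.cons p a : Fin (s + 1) → ι) k) ((Fin.snoc a q : Fin (s + 1) → ι) k) := by
  induction s generalizing p with
  | zero => simp [Fin.snoc]
  | succ s ih =>
    rw [List.ofFn_succ, List.prod_cons, Matrix.mul_apply,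
      ← Equiv.sum_comp (Fin.consEquiv fun _ : Fin (s + 1) => ι), Fintype.sum_prod_type]
    refine Finset.sum_congr rfl fun r _ => ?_
    rw [ih, Finset.mul_sum]
    refine Finset.sum_congr rfl fun a _ => ?_
    rw [Fin.prod_univ_succ (n := s + 1)]
    simp [Fin.consEquiv, ← Fin.cons_snoc_eq_snoc_cons]

lemma trace_list_prod_ofFn {R : Type*} [CommSemiring R] {ι : Type*} [Fintype ι] [DecidableEq ι]
    (s : ℕ) (N : Fin (s + 1) → Matrix ι ι R) :
    (List.ofFn N).prod.trace = ∑ a : Fin (s + 1) → ι, ∏ k,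
      N k (a k) ((Fin.snoc (Fin.tail a) (a 0) : Fin (s + 1) → ι) k) := by
  rw [← Equiv.sum_comp (Fin.consEquiv fun _ : Fin (s + 1) => ι), Fintype.sum_prod_type]
  refine Finset.sum_congr rfl fun p _ => ?_
  rw [Matrix.diag, list_prod_ofFn_apply]
  simp [Fin.consEquiv]

/-- Cauchy–Schwarz for the interleaved bilinear form attached to one representation. -/
lemma norm_sum_trace_le {G : Type*} [Group G] [Fintype G] {m : ℕ}
    (U : G →* Matrix (Fin m) (Fin m) ℂ) (s : ℕ) (f h : (Fin (s + 1) → G) → ℂ) :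
    ‖∑ x, ∑ y, f x * h y * (U (List.ofFn fun k => x k * y k).prod).trace‖ ≤
      √(∑ a : Fin (s + 1) → Fin m, ∑ b : Fin (s + 1) → Fin m,
        ‖∑ x, f x * ∏ k, U (x k) (a k) (b k)‖ ^ 2) *
      √(∑ a : Fin (s + 1) → Fin m, ∑ b : Fin (s + 1) → Fin m,
        ‖∑ x, h x * ∏ k, U (x k) (a k) (b k)‖ ^ 2) := by
  set F : (Fin (s + 1) → Fin m) → (Fin (s + 1) → Fin m) → ℂ :=
    fun a b => ∑ x, f x * ∏ k, U (x k) (a k) (b k)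
  set H : (Fin (s + 1) → Fin m) → (Fin (s + 1) → Fin m) → ℂ :=
    fun a b => ∑ x, h x * ∏ k, U (x k) (a k) (b k)
  let σ (a : Fin (s + 1) → Fin m) : Fin (s + 1) → Fin m := Fin.snoc (Fin.tail a) (a 0)
  have hσ : Function.Bijective σ := by
    refine Finite.injective_iff_bijective.mp fun a b hab => ?_
    obtain ⟨h1, h2⟩ := Fin.snoc_injective2 hab
    rw [← Fin.cons_self_tail a, ← Fin.cons_self_tail b, h1, h2]
  have key : ∑ x, ∑ y, f x * h y * (U (List.ofFn fun k => x k * y k).prod).trace =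
      ∑ a, ∑ b, F a b * H b (σ a) := by
    have htr (x y : Fin (s + 1) → G) : (U (List.ofFn fun k => x k * y k).prod).trace =
        ∑ a : Fin (s + 1) → Fin m, ∑ b : Fin (s + 1) → Fin m,
          (∏ k, U (x k) (a k) (b k)) * ∏ k, U (y k) (b k) (σ a k) := by
      rw [map_list_prod, List.map_ofFn, trace_list_prod_ofFn]
      refine Finset.sum_congr rfl fun a _ => ?_
      simp only [Function.comp_apply, map_mul, Matrix.mul_apply, ← Finset.prod_mul_distrib]
      rw [Fintype.prod_sum]
    calc _ = ∑ x, ∑ y, ∑ a : Fin (s + 1) → Fin m, ∑ b : Fin (s + 1) → Fin m,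
          (f x * ∏ k, U (x k) (a k) (b k)) * (h y * ∏ k, U (y k) (b k) (σ a k)) := by
          refine Finset.sum_congr rfl fun x _ => Finset.sum_congr rfl fun y _ => ?_
          rw [htr, Finset.mul_sum]
          refine Finset.sum_congr rfl fun a _ => ?_
          rw [Finset.mul_sum]
          refine Finset.sum_congr rfl fun b _ => ?_
          ring
      _ = ∑ x, ∑ a : Fin (s + 1) → Fin m, ∑ b : Fin (s + 1) → Fin m, ∑ y,
          (f x * ∏ k, U (x k) (a k) (b k)) * (h y * ∏ k, U (y k) (b k) (σ a k)) := by
          refine Finset.sum_congr rfl fun x _ => ?_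
          rw [Finset.sum_comm]
          exact Finset.sum_congr rfl fun a _ => Finset.sum_comm
      _ = ∑ a : Fin (s + 1) → Fin m, ∑ b : Fin (s + 1) → Fin m, ∑ x, ∑ y,
          (f x * ∏ k, U (x k) (a k) (b k)) * (h y * ∏ k, U (y k) (b k) (σ a k)) := by
          rw [Finset.sum_comm]
          exact Finset.sum_congr rfl fun a _ => Finset.sum_comm
      _ = _ := by simp only [F, H, Finset.sum_mul_sum]
  have hH : ∑ a, ∑ b, ‖H a b‖ ^ 2 = ∑ a, ∑ b, ‖H b (σ a)‖ ^ 2 := by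
    rw [hσ.sum_comp fun a => ∑ b, ‖H b a‖ ^ 2, Finset.sum_comm]
  rw [key, hH, ← Fintype.sum_prod_type' fun a b => F a b * H b (σ a),
    ← Fintype.sum_prod_type' fun a b => ‖F a b‖ ^ 2,
    ← Fintype.sum_prod_type' fun a b => ‖H b (σ a)‖ ^ 2]
  refine (norm_sum_le _ _).trans ?_
  simp only [norm_mul]
  exact Real.sum_mul_le_sqrt_mul_sqrt _ _ _

/-- The spectral bound for the interleaved product, in bilinear form. -/
lemma norm_sum_interleaved_le {G : Type*} [Group G] [Fintype G] [DecidableEq G]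
    (d s : ℕ) (hd : 0 < d)
    (hquasi : ∀ (n : ℕ) (ρ : G →* Matrix (Fin n) (Fin n) ℂ),
      (∀ M : Matrix (Fin n) (Fin n) ℂ, (∀ g : G, M * ρ g = ρ g * M) →
        ∃ c : ℂ, M = c • (1 : Matrix (Fin n) (Fin n) ℂ)) →
      (∃ g : G, ρ g ≠ 1) → d ≤ n)
    (f h : (Fin (s + 1) → G) → ℂ) :
    ‖∑ x, ∑ y, f x * h y *
      ((if (List.ofFn fun k => x k * y k).prod = 1 then (Fintype.card G : ℂ) else 0) - 1)‖ ≤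
      ((d : ℝ) ^ s)⁻¹ * ((Fintype.card G : ℝ) ^ (s + 1) *
        (√(∑ x, ‖f x‖ ^ 2) * √(∑ x, ‖h x‖ ^ 2))) := by
  obtain ⟨n, D, U, S, hU, hS, htr, htrS⟩ := exists_unitary_plancherel d hquasi
  let P (f : (Fin (s + 1) → G) → ℂ) (i : Fin n) : ℝ :=
    ∑ a : Fin (s + 1) → Fin (D i), ∑ b : Fin (s + 1) → Fin (D i),
      ‖∑ x, f x * ∏ k, U i (x k) (a k) (b k)‖ ^ 2
  have hP (f : (Fin (s + 1) → G) → ℂ) (i) : 0 ≤ (D i : ℝ) ^ (s + 1) * P f i := by positivity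
  have hbessel (f : (Fin (s + 1) → G) → ℂ) : ∑ i ∈ S, (D i : ℝ) ^ (s + 1) * P f i ≤
      (Fintype.card G : ℝ) ^ (s + 1) * ∑ x, ‖f x‖ ^ 2 :=
    (Finset.sum_le_sum_of_subset_of_nonneg (Finset.subset_univ _) fun i _ _ => hP f i).trans
      (sum_pow_mul_coeff_le D U hU htr s.succ_pos f)
  have hd' : (0 : ℝ) < (d : ℝ) ^ s := by positivity
  calc _ = ‖∑ i ∈ S, (D i : ℂ) *
        ∑ x, ∑ y, f x * h y * (U i (List.ofFn fun k => x k * y k).prod).trace‖ := by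
        congr 1
        simp only [← htrS, Finset.mul_sum]
        rw [Finset.sum_comm (s := S)]
        refine Finset.sum_congr rfl fun x _ => ?_
        rw [Finset.sum_comm (s := S)]
        exact Finset.sum_congr rfl fun y _ => Finset.sum_congr rfl fun i _ => by ring
    _ ≤ ∑ i ∈ S, (D i : ℝ) * (√(P f i) * √(P h i)) := by
        refine (norm_sum_le _ _).trans (Finset.sum_le_sum fun i _ => ?_)
        rw [norm_mul, Complex.norm_natCast]
        exact mul_le_mul_of_nonneg_left (norm_sum_trace_le (U i) s f h) (Nat.cast_nonneg _)
    _ ≤ ∑ i ∈ S, ((d : ℝ) ^ s)⁻¹ *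
          (√((D i : ℝ) ^ (s + 1) * P f i) * √((D i : ℝ) ^ (s + 1) * P h i)) := by
        refine Finset.sum_le_sum fun i hi => ?_
        have hD : (d : ℝ) ^ s ≤ (D i : ℝ) ^ s := by
          gcongr
          exact_mod_cast hS i hi
        rw [Real.sqrt_mul (by positivity), Real.sqrt_mul (by positivity), mul_mul_mul_comm,
          Real.mul_self_sqrt (by positivity), ← mul_assoc ((d : ℝ) ^ s)⁻¹]
        refine mul_le_mul_of_nonneg_right ?_ <|
          mul_nonneg (Real.sqrt_nonneg _) (Real.sqrt_nonneg _)
        rw [le_inv_mul_iff₀ hd', pow_succ]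
        gcongr
    _ ≤ ((d : ℝ) ^ s)⁻¹ * (√(∑ i ∈ S, (D i : ℝ) ^ (s + 1) * P f i) *
          √(∑ i ∈ S, (D i : ℝ) ^ (s + 1) * P h i)) := by
        rw [← Finset.mul_sum]
        gcongr
        exact Real.sum_sqrt_mul_sqrt_le _ (hP f) (hP h)
    _ ≤ ((d : ℝ) ^ s)⁻¹ * (√((Fintype.card G : ℝ) ^ (s + 1) * ∑ x, ‖f x‖ ^ 2) *
          √((Fintype.card G : ℝ) ^ (s + 1) * ∑ x, ‖h x‖ ^ 2)) := by
        gcongr <;> exact hbessel _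
    _ = _ := by
        rw [Real.sqrt_mul (by positivity), Real.sqrt_mul (by positivity), mul_mul_mul_comm,
          Real.mul_self_sqrt (by positivity)]

/-- Interleaved mixing for uniform distributions on dense subsets `A, B ⊆ G^t`. -/
theorem interleaved_mixing_uniform {G : Type*} [Group G] [Fintype G] [DecidableEq G]
    (d t : ℕ) (ht : 0 < t) (hd : 0 < d)
    (hquasi : ∀ (n : ℕ) (ρ : G →* Matrix (Fin n) (Fin n) ℂ),
      (∀ M : Matrix (Fin n) (Fin n) ℂ, (∀ g : G, M * ρ g = ρ g * M) →
        ∃ c : ℂ, M = c • (1 : Matrix (Fin n) (Fin n) ℂ)) →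
      (∃ g : G, ρ g ≠ 1) → d ≤ n)
    (A B : Finset (Fin t → G)) (hA : A.Nonempty) (hB : B.Nonempty)
    (α β : ℝ)
    (hα : α = (A.card : ℝ) / (Fintype.card G : ℝ) ^ t)
    (hβ : β = (B.card : ℝ) / (Fintype.card G : ℝ) ^ t)
    (X Y : (Fin t → G) → ℝ)
    (hX : ∀ x, X x = if x ∈ A then ((A.card : ℝ))⁻¹ else 0)
    (hY : ∀ y, Y y = if y ∈ B then ((B.card : ℝ))⁻¹ else 0)
    (g : G) :
    |(∑ x : Fin t → G, ∑ y : Fin t → G,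
        if (List.ofFn fun k => x k * y k).prod = g then X x * Y y else 0)
      - 1 / (Fintype.card G : ℝ)| ≤
    (Fintype.card G : ℝ)⁻¹ * ((d : ℝ) ^ (t - 1))⁻¹ * (Real.sqrt (α * β))⁻¹ := by
  obtain ⟨s, rfl⟩ := Nat.exists_eq_succ_of_ne_zero ht.ne'
  set N : ℝ := (Fintype.card G : ℝ) with hN
  have hN0 : 0 < N := by positivity
  have hsum (C : Finset (Fin (s + 1) → G)) (hC : C.Nonempty) (Z : (Fin (s + 1) → G) → ℝ)
      (hZ : ∀ z, Z z = if z ∈ C then (C.card : ℝ)⁻¹ else 0) :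
      ∑ z, Z z = 1 ∧ ∑ z, Z z ^ 2 = (C.card : ℝ)⁻¹ := by
    have : (C.card : ℝ) ≠ 0 := by simpa using hC.ne_empty
    constructor
    · simp [hZ, this]
    · simp only [hZ, ite_pow]
      simp
      field_simp
  obtain ⟨hX1, hX2⟩ := hsum A hA X hX
  obtain ⟨hY1, hY2⟩ := hsum B hB Y hY
  let c : Fin (s + 1) → G := Pi.mulSingle 0 g
  have hc (x y : Fin (s + 1) → G) : (List.ofFn fun k => (c * x) k * y k).prod =
      g * (List.ofFn fun k => x k * y k).prod := by
    simp [c, List.ofFn_succ, mul_assoc]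
  have hshift (F : (Fin (s + 1) → G) → ℝ) : ∑ x, F (c * x) = ∑ x, F x :=
    Equiv.sum_comp (Equiv.mulLeft c) F
  have hmain := norm_sum_interleaved_le d s hd hquasi (fun x => (X (c * x) : ℂ))
    fun y => (Y y : ℂ)
  simp only [Complex.norm_real, Real.norm_eq_abs, sq_abs] at hmain
  rw [hshift fun x => X x ^ 2, hX2, hY2] at hmain
  have hreal : (∑ x, ∑ y, (X (c * x) : ℂ) * Y y *
      ((if (List.ofFn fun k => x k * y k).prod = 1 then (Fintype.card G : ℂ) else 0) - 1)) =
      ((N * ((∑ x : Fin (s + 1) → G, ∑ y : Fin (s + 1) → G,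
        if (List.ofFn fun k => x k * y k).prod = g then X x * Y y else 0) - 1 / N) : ℝ) : ℂ) := by
    have h1 : ∑ x, ∑ y, X (c * x) * Y y = 1 := by
      rw [← Finset.sum_mul_sum, hshift, hX1, hY1, one_mul]
    rw [mul_sub, mul_one_div_cancel hN0.ne', ← h1, ← hshift, Finset.mul_sum,
      ← Finset.sum_sub_distrib, Complex.ofReal_sum]
    refine Finset.sum_congr rfl fun x _ => ?_
    rw [Finset.mul_sum, ← Finset.sum_sub_distrib, Complex.ofReal_sum]
    refine Finset.sum_congr rfl fun y _ => ?_
    simp only [hc, mul_eq_left]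
    split_ifs
    · simp [hN]
      ring
    · simp [hN]
  rw [hreal, Complex.norm_real, Real.norm_eq_abs, abs_mul, abs_of_pos hN0] at hmain
  have hαβ : (√(α * β))⁻¹ = N ^ (s + 1) * (√((A.card : ℝ)⁻¹) * √((B.card : ℝ)⁻¹)) := by
    rw [hα, hβ, ← Real.sqrt_inv, ← Real.sqrt_mul (by positivity)]
    have : ((A.card : ℝ) / N ^ (s + 1) * ((B.card : ℝ) / N ^ (s + 1)))⁻¹ =
        (N ^ (s + 1)) ^ 2 * ((A.card : ℝ)⁻¹ * (B.card : ℝ)⁻¹) := by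
      field_simp
    rw [this, Real.sqrt_mul (by positivity), Real.sqrt_sq (by positivity)]
  rw [hαβ, mul_assoc, le_inv_mul_iff₀ hN0]
  simpa using hmain
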